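/- Let 𝒯 be a finite undirected tree, w : V(𝒯) → ℝ≥0 a weight function, m = w(𝒯), α ∈ (0,1), and let c be an α-centroid of (𝒯,w). Then OPT(𝒯,w) ≥ (1−α)·m + α·w(c) + Σ_{ℋ ∈ 𝒞(𝒯−c)} OPT(ℋ,w), where the sum ranges over the connected components of 𝒯 − c. -/

import Mathlib

open Filter Topology

universe u

variable {V : Type u}

/-- Rooted trees with vertices labelled by elements of `V`. -/
inductive RTree (V : Type u) : Type u where
  | node : V → List (RTree V) → RTree V

namespace RTree

/-- The root of a rooted tree. -/
def root : RTree V → V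
  | node r _ => r

/-- The subtrees rooted at the children of the root. -/
def children : RTree V → List (RTree V)
  | node _ ts => ts

/-- The list of pairs `(v, path from the root to v)` over all vertices `v` of the tree. -/
def pathsFrom : RTree V → List (V × List V)
  | node r ts =>
      (r, [r]) ::
        (ts.attach.map fun t => (t.1.pathsFrom.map fun p => (p.1, r :: p.2))).flatten
  decreasing_by
    simp only [RTree.node.sizeOf_spec]
    have := List.sizeOf_lt_of_mem t.2
    omega

/-- The vertex set of a rooted tree. -/
def vertSet (T : RTree V) : Set V := {v | ∃ p ∈ T.pathsFrom, p.1 = v}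

/-- `Path_T(v)`: the set of vertices on the path in `T` from the root to `v`
(including both endpoints). -/
def pathSet (T : RTree V) (v : V) : Set V := {x | ∃ p ∈ T.pathsFrom, p.1 = v ∧ x ∈ p.2}

/-- The depth of a vertex `v` in `T`; the root has depth 1. -/
noncomputable def depth (T : RTree V) (v : V) : ℕ := (T.pathSet v).ncard

/-- All subtrees of a rooted tree (including the tree itself). -/
def allSubtrees : RTree V → List (RTree V)
  | node r ts => node r ts :: (ts.attach.map fun t => t.1.allSubtrees).flatten
  decreasing_by
    simp only [RTree.node.sizeOf_spec]
    have := List.sizeOf_lt_of_mem t.2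
    omega

/-- Two rooted trees are equivalent (represent the same search tree) if they have
the same root-to-vertex paths. -/
def Equiv (T₁ T₂ : RTree V) : Prop := ∀ v, T₁.pathSet v = T₂.pathSet v

end RTree

/-- `x` and `y` are joined by a walk of `G` staying inside `s`. -/
def ReachIn (G : SimpleGraph V) (s : Set V) (x y : V) : Prop :=
  ∃ p : G.Walk x y, ∀ v ∈ p.support, v ∈ s

/-- The connected component of `x` in the subgraph of `G` induced by `s`. -/
def compIn (G : SimpleGraph V) (s : Set V) (x : V) : Set V := {y | ReachIn G s x y}

/-- The set of connected components of the subgraph of `G` induced by `s`. -/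
def comps (G : SimpleGraph V) (s : Set V) : Set (Set V) := {c | ∃ x ∈ s, c = compIn G s x}

/-- `s` induces a (nonempty) connected subgraph of `G`. -/
def ConnIn (G : SimpleGraph V) (s : Set V) : Prop :=
  s.Nonempty ∧ ∀ x ∈ s, ∀ y ∈ s, ReachIn G s x y

/-- The total weight of a set of vertices. -/
noncomputable def wsum (w : V → ℝ) (s : Set V) : ℝ := ∑ᶠ x ∈ s, w x

/-- `IsSearchTree G s T`: `T` is a search tree on the subgraph of `G` induced by `s`.
Its root `r` is a vertex of `s`, its vertex set is `s`, and the subtrees rooted at the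
children of `r` are search trees on the connected components of the induced subgraph
on `s \ {r}` (one subtree for each component). -/
inductive IsSearchTree (G : SimpleGraph V) : Set V → RTree V → Prop where
  | node {s : Set V} {r : V} {ts : List (RTree V)} :
      r ∈ s →
      (RTree.node r ts).vertSet = s →
      (∀ t ∈ ts, IsSearchTree G (compIn G (s \ {r}) t.root) t) →
      ts.Pairwise (fun t₁ t₂ => compIn G (s \ {r}) t₁.root ≠ compIn G (s \ {r}) t₂.root) →
      IsSearchTree G s (RTree.node r ts)

/-- The cost of a search tree: `∑_x w(x) · depth(x)`, the root having depth 1. -/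
noncomputable def cost (w : V → ℝ) (T : RTree V) : ℝ :=
  ∑ᶠ v ∈ T.vertSet, w v * (T.depth v : ℝ)

/-- The optimum cost of a search tree on the subgraph of `G` induced by `s`. -/
noncomputable def OPT (G : SimpleGraph V) (w : V → ℝ) (s : Set V) : ℝ :=
  sInf (cost w '' {T | IsSearchTree G s T})

/-- `v` is an `α`-centroid of the subgraph of `G` induced by `s` (with weights `w`):
every connected component of the induced subgraph on `s \ {v}` has weight at most
`α` times the weight of `s`. -/
def IsAlphaCentroid (G : SimpleGraph V) (w : V → ℝ) (α : ℝ) (s : Set V) (v : V) : Prop :=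
  v ∈ s ∧ ∀ x ∈ s \ {v}, wsum w (compIn G (s \ {v}) x) ≤ α * wsum w s

/-- `v` is a centroid of the subgraph of `G` induced by `s` (with weights `w`). -/
def IsCentroid (G : SimpleGraph V) (w : V → ℝ) (s : Set V) (v : V) : Prop :=
  v ∈ s ∧ ∀ x ∈ s \ {v}, wsum w (compIn G (s \ {v}) x) ≤ wsum w s / 2

/-- `T` is an `α`-centroid tree on the subgraph of `G` induced by `s`. -/
def IsAlphaCentroidTree (G : SimpleGraph V) (w : V → ℝ) (α : ℝ) (s : Set V) (T : RTree V) :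
    Prop :=
  IsSearchTree G s T ∧ ∀ t ∈ T.allSubtrees, IsAlphaCentroid G w α t.vertSet t.root

/-- `T` is a centroid tree on the subgraph of `G` induced by `s`. -/
def IsCentroidTree (G : SimpleGraph V) (w : V → ℝ) (s : Set V) (T : RTree V) : Prop :=
  IsSearchTree G s T ∧ ∀ t ∈ T.allSubtrees, IsCentroid G w t.vertSet t.root

/-- `cent(𝒯,w)`: the maximum cost of a centroid tree. -/
noncomputable def centCost (G : SimpleGraph V) (w : V → ℝ) (s : Set V) : ℝ :=
  sSup (cost w '' {T | IsCentroidTree G w s T})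

/-- `centᵅ(𝒯,w)`: the maximum cost of an `α`-centroid tree (`0` if none exists, since
`sSup ∅ = 0` in `ℝ`). -/
noncomputable def centCostA (G : SimpleGraph V) (w : V → ℝ) (α : ℝ) (s : Set V) : ℝ :=
  sSup (cost w '' {T | IsAlphaCentroidTree G w α s T})

/-- `b` is a child of `a` in the rooted tree `T`. -/
def ChildRel (T : RTree V) (a b : V) : Prop :=
  ∃ t ∈ T.allSubtrees, t.root = a ∧ ∃ t' ∈ t.children, t'.root = b

namespace RTree

lemma mem_pathsFrom_node {r : V} {ts : List (RTree V)} {p : V × List V} :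
    p ∈ (node r ts).pathsFrom ↔
      p = (r, [r]) ∨ ∃ t ∈ ts, ∃ q ∈ t.pathsFrom, p = (q.1, r :: q.2) := by
  rw [pathsFrom]
  simp only [List.mem_cons, List.mem_flatten, List.mem_map, List.mem_attach, true_and,
    Subtype.exists]
  constructor
  · rintro (h | ⟨l, ⟨t, ht, rfl⟩, hp⟩)
    · exact Or.inl h
    · obtain ⟨q, hq, rfl⟩ := List.mem_map.1 hp
      exact Or.inr ⟨t, ht, q, hq, rfl⟩
  · rintro (h | ⟨t, ht, q, hq, rfl⟩)
    · exact Or.inl h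
    · exact Or.inr ⟨_, ⟨t, ht, rfl⟩, List.mem_map.2 ⟨q, hq, rfl⟩⟩

lemma mem_vertSet_node {r v : V} {ts : List (RTree V)} :
    v ∈ (node r ts).vertSet ↔ v = r ∨ ∃ t ∈ ts, v ∈ t.vertSet := by
  constructor
  · rintro ⟨p, hp, rfl⟩
    rcases mem_pathsFrom_node.1 hp with rfl | ⟨t, ht, q, hq, rfl⟩
    · exact Or.inl rfl
    · exact Or.inr ⟨t, ht, q, hq, rfl⟩
  · rintro (rfl | ⟨t, ht, q, hq, rfl⟩)
    · exact ⟨_, mem_pathsFrom_node.2 (Or.inl rfl), rfl⟩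
    · exact ⟨_, mem_pathsFrom_node.2 (Or.inr ⟨t, ht, q, hq, rfl⟩), rfl⟩

lemma mem_pathSet_node {r v x : V} {ts : List (RTree V)} :
    x ∈ (node r ts).pathSet v ↔
      (v = r ∧ x = r) ∨ ∃ t ∈ ts, v ∈ t.vertSet ∧ (x = r ∨ x ∈ t.pathSet v) := by
  constructor
  · rintro ⟨p, hp, rfl, hx⟩
    rcases mem_pathsFrom_node.1 hp with rfl | ⟨t, ht, q, hq, rfl⟩
    · exact Or.inl ⟨rfl, by simpa using hx⟩
    · refine Or.inr ⟨t, ht, ⟨q, hq, rfl⟩, ?_⟩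
      rcases List.mem_cons.1 hx with h | h
      · exact Or.inl h
      · exact Or.inr ⟨q, hq, rfl, h⟩
  · rintro (⟨rfl, rfl⟩ | ⟨t, ht, ⟨q, hq, rfl⟩, rfl | ⟨q', hq', h, hx⟩⟩)
    · exact ⟨_, mem_pathsFrom_node.2 (Or.inl rfl), rfl, by simp⟩
    · exact ⟨_, mem_pathsFrom_node.2 (Or.inr ⟨t, ht, q, hq, rfl⟩), rfl, by simp⟩
    · exact ⟨_, mem_pathsFrom_node.2 (Or.inr ⟨t, ht, q', hq', rfl⟩), h, by simp [hx]⟩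

lemma root_mem_pathSet {T : RTree V} {v : V} (hv : v ∈ T.vertSet) : T.root ∈ T.pathSet v := by
  obtain ⟨r, ts⟩ := T
  rcases mem_vertSet_node.1 hv with rfl | ⟨t, ht, hvt⟩
  · exact mem_pathSet_node.2 (Or.inl ⟨rfl, rfl⟩)
  · exact mem_pathSet_node.2 (Or.inr ⟨t, ht, hvt, Or.inl rfl⟩)

end RTree

section Connectivity

variable {G : SimpleGraph V} {s t : Set V} {x y z : V}

lemma ReachIn.refl (hx : x ∈ s) : ReachIn G s x x := ⟨.nil, by simpa using hx⟩

lemma ReachIn.symm (h : ReachIn G s x y) : ReachIn G s y x := by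
  obtain ⟨p, hp⟩ := h
  exact ⟨p.reverse, by simpa using hp⟩

lemma ReachIn.trans (h : ReachIn G s x y) (h' : ReachIn G s y z) : ReachIn G s x z := by
  obtain ⟨p, hp⟩ := h
  obtain ⟨q, hq⟩ := h'
  refine ⟨p.append q, fun v hv => ?_⟩
  rcases (SimpleGraph.Walk.mem_support_append_iff p q).1 hv with h | h
  exacts [hp v h, hq v h]

lemma ReachIn.mono (hst : s ⊆ t) (h : ReachIn G s x y) : ReachIn G t x y := by
  obtain ⟨p, hp⟩ := h
  exact ⟨p, fun v hv => hst (hp v hv)⟩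

lemma compIn_subset : compIn G s x ⊆ s := fun _ ⟨p, hp⟩ => hp _ p.end_mem_support

lemma mem_compIn_self (hx : x ∈ s) : x ∈ compIn G s x := ReachIn.refl hx

lemma compIn_eq_of_mem (h : y ∈ compIn G s x) : compIn G s y = compIn G s x := by
  ext z
  exact ⟨fun hz => ReachIn.trans h hz, fun hz => ReachIn.trans (ReachIn.symm h) hz⟩

lemma reachIn_compIn (h : ReachIn G s x y) : ReachIn G (compIn G s x) x y := by
  classical
  obtain ⟨p, hp⟩ := h
  refine ⟨p, fun v hv => ⟨p.takeUntil v hv, fun u hu => hp u ?_⟩⟩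
  exact p.support_takeUntil_subset_support hv hu

lemma connIn_compIn (hx : x ∈ s) : ConnIn G (compIn G s x) :=
  ⟨⟨x, mem_compIn_self hx⟩,
    fun _ hy _ hz => (reachIn_compIn hy).symm.trans (reachIn_compIn hz)⟩

lemma eq_compIn_of_mem_comps {H : Set V} (hH : H ∈ comps G s) (hx : x ∈ H) :
    H = compIn G s x := by
  obtain ⟨y, -, rfl⟩ := hH
  exact (compIn_eq_of_mem hx).symm

lemma compIn_mem_comps (hx : x ∈ s) : compIn G s x ∈ comps G s := ⟨x, hx, rfl⟩

lemma subset_of_mem_comps {H : Set V} (hH : H ∈ comps G s) : H ⊆ s := by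
  obtain ⟨y, -, rfl⟩ := hH
  exact compIn_subset

lemma connIn_of_mem_comps {H : Set V} (hH : H ∈ comps G s) : ConnIn G H := by
  obtain ⟨y, hy, rfl⟩ := hH
  exact connIn_compIn hy

lemma sUnion_comps : ⋃₀ comps G s = s := by
  ext x
  constructor
  · rintro ⟨H, hH, hx⟩
    exact subset_of_mem_comps hH hx
  · exact fun hx => ⟨_, compIn_mem_comps hx, mem_compIn_self hx⟩

lemma pairwiseDisjoint_comps : (comps G s).PairwiseDisjoint id := by
  intro H hH H' hH' hne
  refine Set.disjoint_left.2 fun x hx hx' => hne ?_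
  rw [eq_compIn_of_mem_comps hH hx, eq_compIn_of_mem_comps hH' hx']

end Connectivity

section SearchTrees

variable {G : SimpleGraph V} {s : Set V} {T : RTree V}

lemma IsSearchTree.vertSet_eq (h : IsSearchTree G s T) : T.vertSet = s := by
  cases h with
  | node _ h _ _ => exact h

lemma IsSearchTree.root_mem (h : IsSearchTree G s T) : T.root ∈ s := by
  cases h with
  | node h _ _ _ => exact h

lemma IsSearchTree.self_mem_pathSet (h : IsSearchTree G s T) :
    ∀ v ∈ s, v ∈ T.pathSet v := by
  induction h with
  | @node s r ts hr hv hts _ ih =>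
    intro v hvs
    rw [← hv] at hvs
    rcases RTree.mem_vertSet_node.1 hvs with rfl | ⟨t, ht, hvt⟩
    · exact RTree.mem_pathSet_node.2 (Or.inl ⟨rfl, rfl⟩)
    · refine RTree.mem_pathSet_node.2 (Or.inr ⟨t, ht, hvt, Or.inr (ih t ht v ?_)⟩)
      rwa [← (hts t ht).vertSet_eq]

/-- Search trees on the components of `s \ {r}` assemble to a search tree on `s` with root `r`. -/
lemma exists_isSearchTree_of_comps [Finite V] {r : V} (hr : r ∈ s) (f : Set V → RTree V)
    (hf : ∀ H ∈ comps G (s \ {r}), IsSearchTree G H (f H)) :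
    ∃ T, IsSearchTree G s T ∧ T.pathSet r ⊆ {r} ∧
      ∀ H ∈ comps G (s \ {r}), ∀ v ∈ H, T.pathSet v ⊆ insert r ((f H).pathSet v) := by
  have hfin : (comps G (s \ {r})).Finite := Set.toFinite _
  set l := hfin.toFinset.toList with hl
  have hmem : ∀ H, H ∈ l ↔ H ∈ comps G (s \ {r}) := fun H => by simp [hl]
  have hcomp : ∀ H ∈ comps G (s \ {r}), compIn G (s \ {r}) (f H).root = H := fun H hH =>
    (eq_compIn_of_mem_comps hH (hf H hH).root_mem).symm
  refine ⟨.node r (l.map f), ⟨hr, ?_, ?_, ?_⟩, ?_, ?_⟩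
  · ext v
    simp only [RTree.mem_vertSet_node, List.mem_map, exists_exists_and_eq_and, hmem]
    constructor
    · rintro (rfl | ⟨H, hH, hv⟩)
      · exact hr
      · rw [(hf H hH).vertSet_eq] at hv
        exact (subset_of_mem_comps hH hv).1
    · intro hv
      by_cases hvr : v = r
      · exact Or.inl hvr
      · have hv' : v ∈ s \ {r} := ⟨hv, hvr⟩
        refine Or.inr ⟨_, compIn_mem_comps hv', ?_⟩
        rw [(hf _ (compIn_mem_comps hv')).vertSet_eq]
        exact mem_compIn_self hv'
  · intro t ht
    obtain ⟨H, hH, rfl⟩ := List.mem_map.1 ht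
    rw [hmem] at hH
    rw [hcomp H hH]
    exact hf H hH
  · rw [List.pairwise_map]
    refine (Finset.nodup_toList hfin.toFinset).imp_of_mem fun {a b} ha hb hab => ?_
    rwa [hcomp a ((hmem a).1 ha), hcomp b ((hmem b).1 hb)]
  · intro x hx
    rcases RTree.mem_pathSet_node.1 hx with ⟨-, h⟩ | ⟨t, ht, hrt, -⟩
    · exact h
    · obtain ⟨H, hH, rfl⟩ := List.mem_map.1 ht
      rw [hmem] at hH
      rw [(hf H hH).vertSet_eq] at hrt
      exact absurd rfl (subset_of_mem_comps hH hrt).2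
  · intro H hH v hv x hx
    rcases RTree.mem_pathSet_node.1 hx with ⟨rfl, rfl⟩ | ⟨t, ht, hvt, h⟩
    · exact Or.inl rfl
    · obtain ⟨H', hH', rfl⟩ := List.mem_map.1 ht
      rw [hmem] at hH'
      rw [(hf H' hH').vertSet_eq] at hvt
      have : H' = H := by
        rw [eq_compIn_of_mem_comps hH' hvt, eq_compIn_of_mem_comps hH hv]
      exact this ▸ h

lemma exists_isSearchTree [Finite V] (hs : s.Nonempty) : ∃ T, IsSearchTree G s T := by
  induction hn : s.ncard using Nat.strong_induction_on generalizing s with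
  | _ n ih =>
    subst hn
    obtain ⟨r, hr⟩ := hs
    have : ∀ H, ∃ T, H ∈ comps G (s \ {r}) → IsSearchTree G H T := by
      intro H
      by_cases hH : H ∈ comps G (s \ {r})
      · obtain ⟨T, hT⟩ := ih H.ncard (Set.ncard_lt_ncard (Set.ssubset_iff_of_subset
          ((subset_of_mem_comps hH).trans Set.sdiff_subset) |>.2
          ⟨r, hr, fun h => (subset_of_mem_comps hH h).2 rfl⟩)) (connIn_of_mem_comps hH).1 rfl
        exact ⟨T, fun _ => hT⟩
      · exact ⟨.node r [], fun h => absurd h hH⟩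
    choose f hf using this
    obtain ⟨T, hT, -⟩ := exists_isSearchTree_of_comps hr f hf
    exact ⟨T, hT⟩

/-- A search tree on `s` restricts to a search tree on every connected subset `H` of `s`,
whose root-to-vertex paths are obtained by deleting the vertices outside `H`. -/
lemma IsSearchTree.exists_restrict [Finite V] (hT : IsSearchTree G s T) :
    ∀ H ⊆ s, ConnIn G H →
      ∃ T', IsSearchTree G H T' ∧ ∀ v ∈ H, T'.pathSet v ⊆ T.pathSet v ∩ H := by
  induction hT with
  | @node s r ts hr hv hts _ ih =>
    have key : ∀ K ⊆ s \ {r}, ConnIn G K → ∃ t ∈ ts, (∀ v ∈ K, v ∈ t.vertSet) ∧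
        ∃ T', IsSearchTree G K T' ∧ ∀ v ∈ K, T'.pathSet v ⊆ t.pathSet v ∩ K := by
      intro K hK hKc
      obtain ⟨x, hx⟩ := hKc.1
      have hxs := (hK hx).1
      rw [← hv] at hxs
      obtain ⟨t, ht, hxt⟩ := (RTree.mem_vertSet_node.1 hxs).resolve_left (hK hx).2
      rw [(hts t ht).vertSet_eq] at hxt
      have hsub : K ⊆ compIn G (s \ {r}) t.root := fun y hy =>
        ReachIn.trans hxt ((hKc.2 x hx y hy).mono hK)
      refine ⟨t, ht, fun v hvK => ?_, ih t ht K hsub hKc⟩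
      rw [(hts t ht).vertSet_eq]
      exact hsub hvK
    intro H hHs hHc
    by_cases hrH : r ∈ H
    · have : ∀ K, ∃ T', K ∈ comps G (H \ {r}) → IsSearchTree G K T' ∧
          ∀ v ∈ K, insert r (T'.pathSet v) ⊆ (RTree.node r ts).pathSet v ∩ H := by
        intro K
        by_cases hK : K ∈ comps G (H \ {r})
        · have hKH := subset_of_mem_comps hK
          obtain ⟨t, ht, htv, T', hT', hp⟩ :=
            key K (hKH.trans (Set.sdiff_subset_sdiff_left hHs)) (connIn_of_mem_comps hK)
          refine ⟨T', fun _ => ⟨hT', fun v hvK x hx => ?_⟩⟩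
          rcases hx with rfl | hx
          · exact ⟨RTree.mem_pathSet_node.2 (Or.inr ⟨t, ht, htv v hvK, Or.inl rfl⟩), hrH⟩
          · have := hp v hvK hx
            exact ⟨RTree.mem_pathSet_node.2 (Or.inr ⟨t, ht, htv v hvK, Or.inr this.1⟩),
              (hKH this.2).1⟩
        · exact ⟨.node r [], fun h => absurd h hK⟩
      choose f hf using this
      obtain ⟨T', hT', hr', hp⟩ :=
        exists_isSearchTree_of_comps hrH f fun K hK => (hf K hK).1
      refine ⟨T', hT', fun v hvH => ?_⟩
      by_cases hvr : v = r
      · subst hvr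
        intro x hx
        obtain rfl : x = v := hr' hx
        exact ⟨RTree.mem_pathSet_node.2 (Or.inl ⟨rfl, rfl⟩), hrH⟩
      · have hv' : v ∈ H \ {r} := ⟨hvH, hvr⟩
        have hK := compIn_mem_comps (G := G) hv'
        exact (hp _ hK v (mem_compIn_self hv')).trans ((hf _ hK).2 v (mem_compIn_self hv'))
    · obtain ⟨t, ht, htv, T', hT', hp⟩ := key H (fun x hx => ⟨hHs hx, fun h => hrH (h ▸ hx)⟩) hHc
      exact ⟨T', hT', fun v hvH x hx => ⟨RTree.mem_pathSet_node.2
        (Or.inr ⟨t, ht, htv v hvH, Or.inr (hp v hvH hx).1⟩), (hp v hvH hx).2⟩⟩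

end SearchTrees

section Cost

variable {G : SimpleGraph V} {w : V → ℝ}

lemma cost_nonneg (hw : ∀ x, 0 ≤ w x) (T : RTree V) : 0 ≤ cost w T :=
  finsum_nonneg fun v => finsum_nonneg fun _ => mul_nonneg (hw v) (Nat.cast_nonneg _)

lemma OPT_le_cost (hw : ∀ x, 0 ≤ w x) {s : Set V} {T : RTree V} (hT : IsSearchTree G s T) :
    OPT G w s ≤ cost w T :=
  csInf_le ⟨0, by rintro _ ⟨T, -, rfl⟩; exact cost_nonneg hw T⟩ ⟨T, hT, rfl⟩

lemma finsum_mem_mono [Finite V] {f g : V → ℝ} {s : Set V} (h : ∀ x ∈ s, f x ≤ g x) :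
    ∑ᶠ x ∈ s, f x ≤ ∑ᶠ x ∈ s, g x := by
  have hs : s.Finite := s.toFinite
  rw [finsum_mem_eq_finite_toFinset_sum _ hs, finsum_mem_eq_finite_toFinset_sum _ hs]
  exact Finset.sum_le_sum fun x hx => h x (by simpa using hx)

lemma OPT_le_of_isSearchTree [Finite V] (hw : ∀ x, 0 ≤ w x) {s H : Set V} {T : RTree V}
    (hT : IsSearchTree G s T) (hHs : H ⊆ s) (hH : ConnIn G H) :
    OPT G w H ≤ ∑ᶠ v ∈ H, w v * ((T.pathSet v ∩ H).ncard : ℝ) := by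
  obtain ⟨T', hT', hp⟩ := hT.exists_restrict H hHs hH
  refine (OPT_le_cost hw hT').trans ?_
  rw [cost, hT'.vertSet_eq]
  refine finsum_mem_mono fun v hv => mul_le_mul_of_nonneg_left ?_ (hw v)
  exact_mod_cast Set.ncard_le_ncard (hp v hv)

lemma finsum_mem_comps_OPT_le [Finite V] (hw : ∀ x, 0 ≤ w x) {s u : Set V} {T : RTree V}
    (hT : IsSearchTree G s T) (hu : u ⊆ s) :
    ∑ᶠ H ∈ comps G u, OPT G w H ≤
      ∑ᶠ v ∈ u, w v * ((T.pathSet v ∩ compIn G u v).ncard : ℝ) := by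
  have hfin : (comps G u).Finite := Set.toFinite _
  calc ∑ᶠ H ∈ comps G u, OPT G w H
      ≤ ∑ᶠ H ∈ comps G u, ∑ᶠ v ∈ H, w v * ((T.pathSet v ∩ compIn G u v).ncard : ℝ) := by
        refine finsum_mem_mono fun H hH => ?_
        refine (OPT_le_of_isSearchTree hw hT ((subset_of_mem_comps hH).trans hu)
          (connIn_of_mem_comps hH)).trans (finsum_mem_congr rfl fun v hv => ?_).le
        rw [← eq_compIn_of_mem_comps hH hv]
    _ = ∑ᶠ v ∈ u, w v * ((T.pathSet v ∩ compIn G u v).ncard : ℝ) := by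
        rw [← finsum_mem_sUnion pairwiseDisjoint_comps hfin fun _ _ => Set.toFinite _,
          sUnion_comps]

end Cost

theorem opt_lower_bound_alpha_centroid {V : Type} [Fintype V]
    (G : SimpleGraph V) (hG : G.IsTree) (w : V → ℝ) (hw : ∀ x, 0 ≤ w x)
    (α : ℝ) (hα0 : 0 < α) (hα1 : α < 1)
    (c : V) (hc : IsAlphaCentroid G w α Set.univ c) :
    OPT G w Set.univ ≥
      (1 - α) * wsum w Set.univ + α * w c +
        ∑ᶠ H ∈ comps G (Set.univ \ {c}), OPT G w H := by
  refine le_csInf (Set.Nonempty.image _ (exists_isSearchTree ⟨c, Set.mem_univ c⟩)) ?_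
  rintro _ ⟨T, hT, rfl⟩
  set u : Set V := Set.univ \ {c} with hu
  have hself : ∀ v, v ∈ T.pathSet v := fun v => hT.self_mem_pathSet v trivial
  have hroot : ∀ v, T.root ∈ T.pathSet v := fun v =>
    RTree.root_mem_pathSet (hT.vertSet_eq ▸ Set.mem_univ v)
  have hu_mem : ∀ v, v ∈ u ↔ v ≠ c := fun v => by simp [hu]
  have hsplit : ∀ g : V → ℝ, ∑ᶠ v ∈ (Set.univ : Set V), g v = g c + ∑ᶠ v ∈ u, g v := by
    intro g
    rw [← finsum_mem_insert g (by simp [hu] : c ∉ u) (Set.toFinite u)]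
    congr! 3 with v
    by_cases hv : v = c <;> simp [hu, hv]
  have hm : wsum w Set.univ = w c + ∑ᶠ v ∈ u, w v := hsplit w
  have hum : 0 ≤ ∑ᶠ v ∈ u, w v := finsum_nonneg fun v => finsum_nonneg fun _ => hw v
  have hopt := finsum_mem_comps_OPT_le hw hT (Set.subset_univ u)
  have hcost : cost w T = w c * T.depth c + ∑ᶠ v ∈ u, w v * (T.depth v : ℝ) := by
    rw [cost, hT.vertSet_eq, hsplit]
  have hgap : ∀ v, T.root ∉ compIn G u v →
      (T.pathSet v ∩ compIn G u v).ncard + 1 ≤ T.depth v := fun v hv =>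
    Set.ncard_lt_ncard (Set.ssubset_iff_of_subset Set.inter_subset_left |>.2
      ⟨T.root, hroot v, fun h => hv h.2⟩)
  have hle : ∀ v, (T.pathSet v ∩ compIn G u v).ncard ≤ T.depth v := fun v =>
    Set.ncard_le_ncard Set.inter_subset_left
  have hwc := hw c
  by_cases hr : T.root = c
  · have hdc : (1 : ℝ) ≤ T.depth c := by
      exact_mod_cast (Set.ncard_pos (Set.toFinite _)).2 ⟨c, hself c⟩
    have hsum : ∑ᶠ v ∈ u, w v * ((T.pathSet v ∩ compIn G u v).ncard : ℝ) + ∑ᶠ v ∈ u, w v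
        ≤ ∑ᶠ v ∈ u, w v * (T.depth v : ℝ) := by
      rw [← finsum_mem_add_distrib (Set.toFinite u)]
      refine finsum_mem_mono fun v _ => ?_
      have := hgap v fun h => (hu_mem _).1 (compIn_subset h) hr
      have : ((T.pathSet v ∩ compIn G u v).ncard : ℝ) + 1 ≤ T.depth v := by exact_mod_cast this
      nlinarith [hw v]
    nlinarith
  · have hru : T.root ∈ u := (hu_mem _).2 hr
    have hdc : (2 : ℝ) ≤ T.depth c := by
      have h2 : ({T.root, c} : Set V).ncard ≤ T.depth c :=
        Set.ncard_le_ncard (Set.insert_subset (hroot c) (Set.singleton_subset_iff.2 (hself c)))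
      rw [Set.ncard_pair hr] at h2
      exact_mod_cast h2
    set K := compIn G u T.root with hK
    have hKu : K ⊆ u := compIn_subset
    have hKw : ∑ᶠ v ∈ K, w v ≤ α * wsum w Set.univ := hc.2 _ hru
    have hsub : ∑ᶠ v ∈ K, w v + ∑ᶠ v ∈ u \ K, w v = ∑ᶠ v ∈ u, w v := by
      rw [← finsum_mem_union Set.disjoint_sdiff_right (Set.toFinite _) (Set.toFinite _),
        Set.union_sdiff_cancel hKu]
    have hsum : ∑ᶠ v ∈ u, w v * ((T.pathSet v ∩ compIn G u v).ncard : ℝ) + ∑ᶠ v ∈ u \ K, w v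
        ≤ ∑ᶠ v ∈ u, w v * (T.depth v : ℝ) := by
      have hdiff : ∑ᶠ v ∈ u \ K, w v = ∑ᶠ v ∈ u, (u \ K).indicator w v := by
        refine finsum_congr fun v => ?_
        by_cases hv : v ∈ u \ K
        · simp [hv, hv.1]
        · simp [hv]
      rw [hdiff, ← finsum_mem_add_distrib (Set.toFinite u)]
      refine finsum_mem_mono fun v hvu => ?_
      by_cases hvK : v ∈ K
      · have : ((T.pathSet v ∩ compIn G u v).ncard : ℝ) ≤ T.depth v := by exact_mod_cast hle v
        rw [Set.indicator_of_notMem fun h => h.2 hvK]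
        nlinarith [hw v]
      · have := hgap v fun h => hvK (ReachIn.symm h)
        have : ((T.pathSet v ∩ compIn G u v).ncard : ℝ) + 1 ≤ T.depth v := by exact_mod_cast this
        rw [Set.indicator_of_mem (show v ∈ u \ K from ⟨hvu, hvK⟩)]
        nlinarith [hw v]
    nlinarith
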